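/- Let H be a right quaternionic Hilbert space and T ∈ B(H). Then the continuous spectrum of T equals the continuous S-spectrum of T: σ_c(T) = σ_{S,c}(T). -/

import Mathlib

open MulOpposite Filter Topology Quaternion

noncomputable section

/- We model a right quaternionic Hilbert space as a real Banach space `H` equipped with a
right `ℍ`-module structure (encoded as a `ℍ[ℝ]ᵐᵒᵖ`-module, so that `x·q` is `op q • x`),
compatible with the real structure (`hreal`) and with the norm (`hnorm`). -/

variable {H : Type*} [NormedAddCommGroup H] [NormedSpace ℝ H] [Module ℍ[ℝ]ᵐᵒᵖ H]

/-- The operator `T_λ : x ↦ x·λ - T x`. -/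
def opTlam (T : H →L[ℝ] H) (l : ℍ[ℝ]) : H → H := fun x => op l • x - T x

/-- The operator `Δ_λ(T) = T² - 2 Re(λ) T + |λ|² I`. -/
def opDelta (T : H →L[ℝ] H) (l : ℍ[ℝ]) : H → H :=
  fun x => T (T x) - (2 * l.re) • T x + (‖l‖ ^ 2) • x

/-- A map is right `ℍ`-linear when it commutes with the right quaternionic scalar action
(together with additivity, which is automatic for the bundled maps we use). -/
def IsRightQLinear (S : H → H) : Prop := ∀ (q : ℍ[ℝ]) (x : H), S (op q • x) = op q • S x

/-- Invertibility in `B_ℝ(H)`: existence of a two-sided inverse which is a bounded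
`ℝ`-linear operator. -/
def InvertibleInBR (f : H → H) : Prop :=
  ∃ S : H →L[ℝ] H, (∀ x, S (f x) = x) ∧ (∀ x, f (S x) = x)

/-- Invertibility in `B(H)`: existence of a two-sided inverse which is a bounded
right `ℍ`-linear operator. -/
def InvertibleInBH (f : H → H) : Prop :=
  ∃ S : H →L[ℝ] H, IsRightQLinear (S : H → H) ∧ (∀ x, S (f x) = x) ∧ (∀ x, f (S x) = x)

/-- An operator is bounded below if `‖f x‖ ≥ k ‖x‖` for some `k > 0`. -/
def BoundedBelowOp (f : H → H) : Prop := ∃ k > 0, ∀ x : H, k * ‖x‖ ≤ ‖f x‖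

/-- The right spectrum `σ(T)`. -/
def rightSpectrum (T : H →L[ℝ] H) : Set ℍ[ℝ] := {l | ¬ InvertibleInBR (opTlam T l)}

/-- The S-spectrum `σ_S(T)`. -/
def sSpectrum (T : H →L[ℝ] H) : Set ℍ[ℝ] := {l | ¬ InvertibleInBH (opDelta T l)}

/-- The point spectrum `σ_p(T)`. -/
def pointSpectrum (T : H →L[ℝ] H) : Set ℍ[ℝ] := {l | ∃ x : H, x ≠ 0 ∧ opTlam T l x = 0}

/-- The point S-spectrum `σ_{S,p}(T)`. -/
def sPointSpectrum (T : H →L[ℝ] H) : Set ℍ[ℝ] := {l | ∃ x : H, x ≠ 0 ∧ opDelta T l x = 0}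

/-- The residual spectrum `σ_r(T)`. -/
def residualSpectrum (T : H →L[ℝ] H) : Set ℍ[ℝ] :=
  {l | l ∉ pointSpectrum T ∧ ¬ Dense (Set.range (opTlam T l))}

/-- The residual S-spectrum `σ_{S,r}(T)`. -/
def sResidualSpectrum (T : H →L[ℝ] H) : Set ℍ[ℝ] :=
  {l | l ∉ sPointSpectrum T ∧ ¬ Dense (Set.range (opDelta T l))}

/-- The continuous spectrum `σ_c(T)`. -/
def continuousSpectrum (T : H →L[ℝ] H) : Set ℍ[ℝ] :=
  {l | l ∉ pointSpectrum T ∧ l ∉ residualSpectrum T ∧ ¬ BoundedBelowOp (opTlam T l)}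

/-- The continuous S-spectrum `σ_{S,c}(T)`. -/
def sContinuousSpectrum (T : H →L[ℝ] H) : Set ℍ[ℝ] :=
  {l | l ∉ sPointSpectrum T ∧ l ∉ sResidualSpectrum T ∧ ¬ BoundedBelowOp (opDelta T l)}

/-- A purely imaginary quaternion orthogonal to `l` intertwines `star l` and `l`. -/
theorem mul_star_eq_mul_of_orthogonal {s l : ℍ[ℝ]} (hre : s.re = 0)
    (horth : s.imI * l.imI + s.imJ * l.imJ + s.imK * l.imK = 0) : s * star l = l * s := by
  apply Quaternion.ext <;>
    simp only [Quaternion.re_mul, Quaternion.imI_mul, Quaternion.imJ_mul, Quaternion.imK_mul,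
      Quaternion.re_star, Quaternion.imI_star, Quaternion.imJ_star, Quaternion.imK_star, hre] <;>
    linarith

/-- Every quaternion is conjugate to its `star`. -/
theorem exists_ne_zero_mul_star_eq_mul (l : ℍ[ℝ]) : ∃ s : ℍ[ℝ], s ≠ 0 ∧ s * star l = l * s := by
  by_cases h : l.imI = 0 ∧ l.imJ = 0
  · refine ⟨⟨0, 1, 0, 0⟩, fun hs => ?_, mul_star_eq_mul_of_orthogonal rfl (by simp [h.1])⟩
    simpa using congrArg QuaternionAlgebra.imI hs
  · refine ⟨⟨0, l.imJ, -l.imI, 0⟩, fun hs => h ⟨?_, ?_⟩,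
      mul_star_eq_mul_of_orthogonal rfl (by simp; ring)⟩
    · simpa using congrArg QuaternionAlgebra.imJ hs
    · simpa using congrArg QuaternionAlgebra.imI hs

theorem continuous_op_smul {E : Type*} [NormedAddCommGroup E] [Module ℍ[ℝ]ᵐᵒᵖ E]
    (hnorm : ∀ (x : E) (q : ℍ[ℝ]), ‖op q • x‖ = ‖x‖ * ‖q‖) (q : ℍ[ℝ]) :
    Continuous fun x : E => op q • x :=
  AddMonoidHomClass.continuous_of_bound (DistribSMul.toAddMonoidHom E (op q)) ‖q‖ fun x => by
    simp [hnorm, mul_comm]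

theorem continuous_opTlam (hnorm : ∀ (x : H) (q : ℍ[ℝ]), ‖op q • x‖ = ‖x‖ * ‖q‖)
    (T : H →L[ℝ] H) (l : ℍ[ℝ]) : Continuous (opTlam T l) :=
  (continuous_op_smul hnorm l).sub T.continuous

theorem opTlam_star_comp_opTlam {T : H →L[ℝ] H} (hT : IsRightQLinear (T : H → H))
    (hreal : ∀ (r : ℝ) (x : H), op ((r : ℍ[ℝ])) • x = r • x) (l : ℍ[ℝ]) (x : H) :
    opTlam T (star l) (opTlam T l x) = opDelta T l x := by
  have hsum : op (star l) • T x + op l • T x = (2 * l.re) • T x := by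
    rw [← hreal, ← add_smul, ← op_add, Quaternion.star_add_self']
  have hmul : op (star l) • op l • x = (‖l‖ ^ 2) • x := by
    rw [← hreal, smul_smul, ← op_mul, Quaternion.self_mul_star, Quaternion.normSq_eq_norm_mul_self,
      sq]
  simp only [opTlam, opDelta, smul_sub, map_sub, hT l x, hmul, ← hsum]
  abel

theorem opTlam_comp_opTlam_star {T : H →L[ℝ] H} (hT : IsRightQLinear (T : H → H))
    (hreal : ∀ (r : ℝ) (x : H), op ((r : ℍ[ℝ])) • x = r • x) (l : ℍ[ℝ]) (x : H) :
    opTlam T l (opTlam T (star l) x) = opDelta T l x := by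
  simpa [opDelta] using opTlam_star_comp_opTlam hT hreal (star l) x

/-- `T_{star λ}` is intertwined with `T_λ` by an invertible right multiplication. -/
theorem exists_opTlam_star_op_smul {T : H →L[ℝ] H} (hT : IsRightQLinear (T : H → H)) (l : ℍ[ℝ]) :
    ∃ s : ℍ[ℝ], s ≠ 0 ∧ ∀ x, opTlam T (star l) (op s • x) = op s • opTlam T l x := by
  obtain ⟨s, hs, hsl⟩ := exists_ne_zero_mul_star_eq_mul l
  refine ⟨s, hs, fun x => ?_⟩
  simp only [opTlam, smul_sub, hT s x, smul_smul, ← op_mul, hsl]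

theorem mem_pointSpectrum_of_star {T : H →L[ℝ] H} (hT : IsRightQLinear (T : H → H)) {l : ℍ[ℝ]}
    (h : star l ∈ pointSpectrum T) : l ∈ pointSpectrum T := by
  obtain ⟨s, hs, hsT⟩ := exists_opTlam_star_op_smul hT (star l)
  obtain ⟨x, hx, hTx⟩ := h
  rw [star_star] at hsT
  refine ⟨op s • x, fun h0 => hx ?_, by rw [hsT, hTx, smul_zero]⟩
  exact (smul_eq_zero_iff_right ((op_ne_zero_iff s).2 hs)).1 h0

theorem pointSpectrum_eq_sPointSpectrum {T : H →L[ℝ] H} (hT : IsRightQLinear (T : H → H))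
    (hreal : ∀ (r : ℝ) (x : H), op ((r : ℍ[ℝ])) • x = r • x) :
    pointSpectrum T = sPointSpectrum T := by
  ext l
  constructor
  · rintro ⟨x, hx, hTx⟩
    refine ⟨x, hx, ?_⟩
    rw [← opTlam_star_comp_opTlam hT hreal, hTx]
    simp [opTlam]
  · rintro ⟨x, hx, hDx⟩
    rw [← opTlam_star_comp_opTlam hT hreal] at hDx
    by_cases h0 : opTlam T l x = 0
    · exact ⟨x, hx, h0⟩
    · exact mem_pointSpectrum_of_star hT ⟨_, h0, hDx⟩

theorem denseRange_opTlam_star {T : H →L[ℝ] H} (hT : IsRightQLinear (T : H → H))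
    (hnorm : ∀ (x : H) (q : ℍ[ℝ]), ‖op q • x‖ = ‖x‖ * ‖q‖) {l : ℍ[ℝ]}
    (h : DenseRange (opTlam T l)) : DenseRange (opTlam T (star l)) := by
  obtain ⟨s, hs, hsT⟩ := exists_opTlam_star_op_smul hT l
  have hsurj : Function.Surjective fun x : H => op s • x := fun x =>
    ⟨op s⁻¹ • x, by simp [smul_smul, hs]⟩
  refine Dense.mono ?_ (hsurj.denseRange.comp h (continuous_op_smul hnorm s))
  rintro _ ⟨x, rfl⟩
  exact ⟨op s • x, hsT x⟩

theorem denseRange_opTlam_iff_opDelta {T : H →L[ℝ] H} (hT : IsRightQLinear (T : H → H))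
    (hreal : ∀ (r : ℝ) (x : H), op ((r : ℍ[ℝ])) • x = r • x)
    (hnorm : ∀ (x : H) (q : ℍ[ℝ]), ‖op q • x‖ = ‖x‖ * ‖q‖) (l : ℍ[ℝ]) :
    DenseRange (opTlam T l) ↔ DenseRange (opDelta T l) := by
  constructor
  · intro h
    rw [← funext (opTlam_star_comp_opTlam hT hreal l)]
    exact (denseRange_opTlam_star hT hnorm h).comp h (continuous_opTlam hnorm T _)
  · intro h
    refine Dense.mono ?_ h
    rintro _ ⟨x, rfl⟩
    exact ⟨_, opTlam_comp_opTlam_star hT hreal l x⟩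

theorem boundedBelowOp_opTlam_star {T : H →L[ℝ] H} (hT : IsRightQLinear (T : H → H))
    (hnorm : ∀ (x : H) (q : ℍ[ℝ]), ‖op q • x‖ = ‖x‖ * ‖q‖) {l : ℍ[ℝ]}
    (h : BoundedBelowOp (opTlam T l)) : BoundedBelowOp (opTlam T (star l)) := by
  obtain ⟨s, hs, hsT⟩ := exists_opTlam_star_op_smul hT l
  obtain ⟨k, hk, hb⟩ := h
  refine ⟨k, hk, fun x => ?_⟩
  obtain ⟨y, rfl⟩ : ∃ y : H, op s • y = x :=
    ⟨op s⁻¹ • x, by simp [smul_smul, hs]⟩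
  rw [hsT, hnorm, hnorm, ← mul_assoc]
  exact mul_le_mul_of_nonneg_right (hb y) (norm_nonneg s)

theorem norm_opTlam_le (hnorm : ∀ (x : H) (q : ℍ[ℝ]), ‖op q • x‖ = ‖x‖ * ‖q‖)
    (T : H →L[ℝ] H) (l : ℍ[ℝ]) (x : H) : ‖opTlam T l x‖ ≤ (‖l‖ + ‖T‖) * ‖x‖ :=
  calc ‖opTlam T l x‖ ≤ ‖op l • x‖ + ‖T x‖ := norm_sub_le _ _
    _ ≤ ‖x‖ * ‖l‖ + ‖T‖ * ‖x‖ := add_le_add (hnorm x l).le (T.le_opNorm x)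
    _ = (‖l‖ + ‖T‖) * ‖x‖ := by ring

theorem boundedBelowOp_opTlam_iff_opDelta {T : H →L[ℝ] H} (hT : IsRightQLinear (T : H → H))
    (hreal : ∀ (r : ℝ) (x : H), op ((r : ℍ[ℝ])) • x = r • x)
    (hnorm : ∀ (x : H) (q : ℍ[ℝ]), ‖op q • x‖ = ‖x‖ * ‖q‖) (l : ℍ[ℝ]) :
    BoundedBelowOp (opTlam T l) ↔ BoundedBelowOp (opDelta T l) := by
  constructor
  · intro h
    obtain ⟨k', hk', hb'⟩ := boundedBelowOp_opTlam_star hT hnorm h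
    obtain ⟨k, hk, hb⟩ := h
    refine ⟨k' * k, mul_pos hk' hk, fun x => ?_⟩
    rw [← opTlam_star_comp_opTlam hT hreal, mul_assoc]
    exact (mul_le_mul_of_nonneg_left (hb x) hk'.le).trans (hb' _)
  · rintro ⟨k, hk, hb⟩
    have hC : 0 < ‖star l‖ + ‖T‖ + 1 := by positivity
    refine ⟨k / (‖star l‖ + ‖T‖ + 1), div_pos hk hC, fun x => ?_⟩
    rw [div_mul_eq_mul_div, div_le_iff₀' hC]
    have hle := (hb x).trans_eq (congrArg norm (opTlam_star_comp_opTlam hT hreal l x).symm)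
    have hup := norm_opTlam_le hnorm T (star l) (opTlam T l x)
    linarith [norm_nonneg (opTlam T l x)]

/-- The continuous spectrum equals the continuous S-spectrum: `σ_c(T) = σ_{S,c}(T)`. -/
theorem continuous_spectrum_eq_sContinuousSpectrum [CompleteSpace H] (T : H →L[ℝ] H)
    (hT : IsRightQLinear (T : H → H))
    (hreal : ∀ (r : ℝ) (x : H), op ((r : ℍ[ℝ])) • x = r • x)
    (hnorm : ∀ (x : H) (q : ℍ[ℝ]), ‖op q • x‖ = ‖x‖ * ‖q‖) :
    continuousSpectrum T = sContinuousSpectrum T := by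
  have hp := pointSpectrum_eq_sPointSpectrum hT hreal
  ext l
  have hd : Dense (Set.range (opTlam T l)) ↔ Dense (Set.range (opDelta T l)) :=
    denseRange_opTlam_iff_opDelta hT hreal hnorm l
  simp only [continuousSpectrum, sContinuousSpectrum, residualSpectrum, sResidualSpectrum,
    Set.mem_ofPred_eq, hp, hd, boundedBelowOp_opTlam_iff_opDelta hT hreal hnorm l]
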